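/- arXiv:2301.06806 — 2 statements merged into one kernel-verified Lean document; each statement's English description precedes it below -/
import Mathlib

section
/- Let f : ℝ^d → ℝ be differentiable and μ-strongly convex with μ > 0, and let α > 0. Then the Moreau envelope F(x) = inf_{z ∈ ℝ^d} (f(z) + ‖z − x‖²/(2α)) is μ/(1 + αμ)-strongly convex on ℝ^d. In particular, if α ≤ 1/μ, then F is (μ/2)-strongly convex. -/
lemma moreau_aux_comb {E : Type*} [NormedAddCommGroup E] [InnerProductSpace ℝ E] (u v : E)
    (a b : ℝ) (hab : a + b = 1) :
    ‖a • u + b • v‖ ^ 2 = a * ‖u‖ ^ 2 + b * ‖v‖ ^ 2 - a * b * ‖u - v‖ ^ 2 := by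
  obtain rfl : b = 1 - a := by linarith
  rw [norm_add_sq_real, norm_sub_sq_real, norm_smul, norm_smul, real_inner_smul_left,
    real_inner_smul_right, mul_pow, mul_pow, Real.norm_eq_abs, Real.norm_eq_abs, sq_abs, sq_abs]
  ring

lemma moreau_aux_ineq {E : Type*} [NormedAddCommGroup E] [InnerProductSpace ℝ E] (p q : E)
    (μ α : ℝ) (hμ : 0 < μ) (hα : 0 < α) :
    μ / (1 + α * μ) / 2 * ‖q‖ ^ 2 ≤ μ / 2 * ‖p‖ ^ 2 + ‖p - q‖ ^ 2 / (2 * α) := by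
  have h : 0 ≤ ‖(1 + α * μ) • p - q‖ ^ 2 := sq_nonneg _
  have hc : 0 < 1 + α * μ := by positivity
  rw [norm_sub_sq_real, norm_smul, real_inner_smul_left, mul_pow, Real.norm_eq_abs, sq_abs] at h
  rw [norm_sub_sq_real]
  have key : μ / 2 * ‖p‖ ^ 2 + (‖p‖ ^ 2 - 2 * inner ℝ p q + ‖q‖ ^ 2) / (2 * α)
      - μ / (1 + α * μ) / 2 * ‖q‖ ^ 2
      = ((1 + α * μ) ^ 2 * ‖p‖ ^ 2 - 2 * ((1 + α * μ) * inner ℝ p q) + ‖q‖ ^ 2)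
        / (2 * α * (1 + α * μ)) := by
    field_simp
    ring
  have : 0 ≤ ((1 + α * μ) ^ 2 * ‖p‖ ^ 2 - 2 * ((1 + α * μ) * inner ℝ p q) + ‖q‖ ^ 2)
        / (2 * α * (1 + α * μ)) := by positivity
  linarith

lemma moreau_aux_grad {E : Type*} [NormedAddCommGroup E] [InnerProductSpace ℝ E] (h : E → ℝ)
    (hc : ConvexOn ℝ Set.univ h) (hd : DifferentiableAt ℝ h 0) (w : E) :
    h 0 + fderiv ℝ h 0 w ≤ h w := by
  have h1 : ConvexOn ℝ Set.univ (fun t : ℝ => h (t • w)) := by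
    have := hc.comp_linearMap (LinearMap.toSpanSingleton ℝ E w)
    simpa [Function.comp_def] using this
  have h2 : HasDerivAt (fun t : ℝ => h (t • w)) (fderiv ℝ h 0 w) 0 := by
    have e : HasDerivAt (fun t : ℝ => t • w) w 0 := by
      simpa using (hasDerivAt_id (0 : ℝ)).smul_const w
    have hf : HasFDerivAt h (fderiv ℝ h 0) ((0 : ℝ) • w) := by
      rw [zero_smul]; exact hd.hasFDerivAt
    exact hf.comp_hasDerivAt (0 : ℝ) e
  have h3 := h1.le_slope_of_hasDerivAt (Set.mem_univ 0) (Set.mem_univ 1) zero_lt_one h2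
  simp [slope_def_field] at h3
  linarith

lemma moreau_aux_bdd {E : Type*} [NormedAddCommGroup E] [InnerProductSpace ℝ E] (f : E → ℝ)
    (μ α : ℝ) (hμ : 0 < μ) (hα : 0 < α) (hdiff : Differentiable ℝ f)
    (hsc : ConvexOn ℝ Set.univ (fun x => f x - μ / 2 * ‖x‖ ^ 2)) (x : E) :
    BddBelow (Set.range fun w => f w + ‖w - x‖ ^ 2 / (2 * α)) := by
  set h : E → ℝ := fun x => f x - μ / 2 * ‖x‖ ^ 2 with hh
  have hd : DifferentiableAt ℝ h 0 :=
    (hdiff 0).sub ((differentiable_id.norm_sq ℝ 0).const_mul _)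
  set L := ‖fderiv ℝ h 0‖
  refine ⟨h 0 - L ^ 2 / (2 * μ), ?_⟩
  rintro _ ⟨w, rfl⟩
  have h1 := moreau_aux_grad h hsc hd w
  have h2 : -(L * ‖w‖) ≤ fderiv ℝ h 0 w :=
    (abs_le.1 ((fderiv ℝ h 0).le_opNorm w)).1
  have h3 : 0 ≤ ‖w - x‖ ^ 2 / (2 * α) := by positivity
  have h4 : L ^ 2 / (2 * μ) - L * ‖w‖ + μ / 2 * ‖w‖ ^ 2 = (L - μ * ‖w‖) ^ 2 / (2 * μ) := by
    field_simp
    ring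
  have h5 : 0 ≤ (L - μ * ‖w‖) ^ 2 / (2 * μ) := by positivity
  have h6 : h w = f w - μ / 2 * ‖w‖ ^ 2 := rfl
  show h 0 - L ^ 2 / (2 * μ) ≤ f w + ‖w - x‖ ^ 2 / (2 * α)
  linarith

lemma moreau_aux_strong {E : Type*} [NormedAddCommGroup E] [InnerProductSpace ℝ E] (f : E → ℝ)
    (μ α : ℝ) (hμ : 0 < μ) (hα : 0 < α) (hdiff : Differentiable ℝ f)
    (hsc : ConvexOn ℝ Set.univ (fun x => f x - μ / 2 * ‖x‖ ^ 2)) :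
    StrongConvexOn Set.univ (μ / (1 + α * μ))
      (fun x => ⨅ w : E, (f w + ‖w - x‖ ^ 2 / (2 * α))) := by
  have hb := moreau_aux_bdd f μ α hμ hα hdiff hsc
  have hs := strongConvexOn_iff_convex.2 hsc
  refine ⟨convex_univ, fun x _ y _ a b ha hb' hab => le_of_forall_pos_le_add fun ε hε => ?_⟩
  obtain ⟨u, hu⟩ := exists_lt_of_ciInf_lt
    (show (⨅ w : E, (f w + ‖w - x‖ ^ 2 / (2 * α))) < _ from lt_add_of_pos_right _ hε)
  obtain ⟨v, hv⟩ := exists_lt_of_ciInf_lt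
    (show (⨅ w : E, (f w + ‖w - y‖ ^ 2 / (2 * α))) < _ from lt_add_of_pos_right _ hε)
  have h1 := ciInf_le (hb (a • x + b • y)) (a • u + b • v)
  have h2 := hs.2 (Set.mem_univ u) (Set.mem_univ v) ha hb' hab
  have h3 := moreau_aux_comb (u - x) (v - y) a b hab
  have e1 : a • u + b • v - (a • x + b • y) = a • (u - x) + b • (v - y) := by module
  have e2 : u - x - (v - y) = (u - v) - (x - y) := by abel
  rw [e2] at h3
  have h4 := mul_le_mul_of_nonneg_left (moreau_aux_ineq (u - v) (x - y) μ α hμ hα)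
    (mul_nonneg ha hb')
  have h5 := mul_le_mul_of_nonneg_left hu.le ha
  have h6 := mul_le_mul_of_nonneg_left hv.le hb'
  simp only [smul_eq_mul] at h2 ⊢
  simp only [e1, h3] at h1
  have h7 : a * ε + b * ε = ε := by rw [← add_mul, hab, one_mul]
  refine h1.trans ?_
  simp only [div_eq_mul_inv _ (2 * α)] at h4 h5 h6 ⊢
  linarith

/-- For differentiable μ-strongly convex f (μ > 0) and α > 0, the
Moreau envelope F(x) = inf_z (f(z) + ‖z − x‖²/(2α)) is μ/(1 + αμ)-strongly convex;
in particular, if α ≤ 1/μ, then F is (μ/2)-strongly convex.  (g is m-strongly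
convex iff x ↦ g(x) − (m/2)‖x‖² is convex.) -/
theorem moreau_envelope_strongly_convex {d : ℕ}
    (f : EuclideanSpace ℝ (Fin d) → ℝ) (μ α : ℝ) (hμ : 0 < μ) (hα : 0 < α)
    (hdiff : Differentiable ℝ f)
    (hsc : ConvexOn ℝ Set.univ (fun x => f x - μ / 2 * ‖x‖ ^ 2)) :
    ConvexOn ℝ Set.univ (fun x =>
      (⨅ w : EuclideanSpace ℝ (Fin d), (f w + ‖w - x‖ ^ 2 / (2 * α))) -
        (μ / (1 + α * μ)) / 2 * ‖x‖ ^ 2) ∧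
    (α ≤ 1 / μ → ConvexOn ℝ Set.univ (fun x =>
      (⨅ w : EuclideanSpace ℝ (Fin d), (f w + ‖w - x‖ ^ 2 / (2 * α))) -
        (μ / 2) / 2 * ‖x‖ ^ 2)) := by
  have h := moreau_aux_strong f μ α hμ hα hdiff hsc
  refine ⟨strongConvexOn_iff_convex.1 h, fun hle => strongConvexOn_iff_convex.1 (h.mono ?_)⟩
  have : α * μ ≤ 1 := by rwa [le_div_iff₀ hμ] at hle
  have : 0 < α * μ := by positivity
  gcongr
  linarith
end

section
/- Fix integers n, τ, k ≥ 1, reals 0 < μ ≤ L, κ = L/μ, and task losses f_1, …, f_n : ℝ^d → ℝ, each L-smooth and μ-strongly convex. Let α, β, δ satisfy 0 < α ≤ 1/L, 0 < β ≤ 1/(20L), and 0 ≤ δ ≤ 1/(4√κ). For each i let z_i : ℝ^d → ℝ^d map x to the unique minimizer of w ↦ f_i(w) + ‖w − x‖²/(2α), and set ∇F_i(x) = (x − z_i(x))/α. Let x* ∈ ℝ^d satisfy Σ_{i=1}^n ∇F_i(x*) = 0, and let σ*² = (1/n)·Σ_{i=1}^n ‖∇F_i(x*)‖². Consider any FO-MuML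 process: x^0(S) = x^0, and for each history S of length t+1 with current batch (i_{t,0},…,i_{t,τ−1}), points ẑ_{t,j}(S) ∈ ℝ^d satisfying ‖(x^t(S) − ẑ_{t,j}(S))/α − ∇F_{i_{t,j}}(x^t(S))‖ ≤ δ·‖∇F_{i_{t,j}}(x^t(S))‖, and x^{t+1}(S) = x^t(S) − (β/τ)·Σ_{j<τ} ∇f_{i_{t,j}}(ẑ_{t,j}(S)). Then the uniform average over all histories S ∈ ({1,…,n}^τ)^k of ‖x^k(S) − x*‖² is at most (1 − βμ/4)^k·‖x^0 − x*‖² + (16/μ)·( 2δ²/μ + β/τ + βδ² )·σ*². -/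
section Helpers

variable {E : Type*} [NormedAddCommGroup E] [InnerProductSpace ℝ E]

/-- Resampling one coordinate. -/
lemma sum_update_resample {ι κ : Type*} [Fintype ι] [DecidableEq ι] [Fintype κ]
    (t : ι) (φ : (ι → κ) → ℝ) :
    ∑ S : ι → κ, ∑ b : κ, φ (Function.update S t b) = (Fintype.card κ : ℝ) * ∑ S, φ S := by
  have h1 : ∑ S : ι → κ, ∑ b : κ, φ (Function.update S t b)
      = ∑ p : (ι → κ) × κ, φ (Function.update p.1 t p.2) :=
    (Fintype.sum_prod_type (fun p : (ι → κ) × κ => φ (Function.update p.1 t p.2))).symm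
  have hinv : Function.Involutive
      (fun p : (ι → κ) × κ => ((Function.update p.1 t p.2, p.1 t) : (ι → κ) × κ)) := by
    rintro ⟨S, b⟩
    simp
  have h2 : ∑ p : (ι → κ) × κ, φ (Function.update p.1 t p.2) = ∑ p : (ι → κ) × κ, φ p.1 :=
    Fintype.sum_equiv hinv.toPerm _ _ (fun p => rfl)
  rw [h1, h2, Fintype.sum_prod_type]
  simp [Finset.mul_sum]

lemma sum_coord {τ n : ℕ} (hn : 1 ≤ n) (j : Fin τ) (ψ : Fin n → ℝ) :
    ∑ b : Fin τ → Fin n, ψ (b j)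
      = (Fintype.card (Fin τ → Fin n) : ℝ) * ((1 / (n : ℝ)) * ∑ i, ψ i) := by
  have h := sum_update_resample (κ := Fin n) j (fun b => ψ (b j))
  have hn' : (n : ℝ) ≠ 0 := by positivity
  simp only [Function.update_self, Fintype.card_fin, Finset.sum_const, nsmul_eq_mul,
    Finset.card_univ] at h
  field_simp
  linarith

lemma sum_avg_coord {τ n : ℕ} (hn : 1 ≤ n) (hτ : 1 ≤ τ) (ψ : Fin n → ℝ) :
    ∑ b : Fin τ → Fin n, (1 / (τ : ℝ)) * ∑ j, ψ (b j)
      = (Fintype.card (Fin τ → Fin n) : ℝ) * ((1 / (n : ℝ)) * ∑ i, ψ i) := by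
  have hτ' : (τ : ℝ) ≠ 0 := by positivity
  rw [← Finset.mul_sum, Finset.sum_comm]
  simp_rw [sum_coord hn]
  rw [Finset.sum_const, Finset.card_univ, Fintype.card_fin, nsmul_eq_mul]
  field_simp

lemma sum_cross {τ n : ℕ} (hn : 1 ≤ n) (s : Fin n → E) (hs : ∑ i, s i = 0)
    (j l : Fin τ) (hjl : l ≠ j) :
    ∑ b : Fin τ → Fin n, inner ℝ (s (b j)) (s (b l)) = 0 := by
  have h := sum_update_resample (κ := Fin n) j (fun b => inner ℝ (s (b j)) (s (b l)))
  have hn' : (n : ℝ) ≠ 0 := by positivity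
  simp only [Function.update_self, Function.update_of_ne hjl, ← sum_inner, hs, inner_zero_left,
    Finset.sum_const_zero, Fintype.card_fin] at h
  rcases mul_eq_zero.mp h.symm with h | h
  · exact absurd h hn'
  · exact h

lemma sum_batch_var {τ n : ℕ} (hn : 1 ≤ n) (hτ : 1 ≤ τ) (s : Fin n → E) (hs : ∑ i, s i = 0) :
    ∑ b : Fin τ → Fin n, ‖(1 / (τ : ℝ)) • ∑ j, s (b j)‖ ^ 2
      = (Fintype.card (Fin τ → Fin n) : ℝ) * ((1 / (n : ℝ)) * ∑ i, ‖s i‖ ^ 2) / τ := by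
  have hτ' : (τ : ℝ) ≠ 0 := by positivity
  have h1 : ∀ b : Fin τ → Fin n, ‖(1 / (τ : ℝ)) • ∑ j, s (b j)‖ ^ 2
      = (1 / (τ : ℝ)) ^ 2 * ∑ j, ∑ l, inner ℝ (s (b j)) (s (b l)) := by
    intro b
    rw [norm_smul, mul_pow, ← real_inner_self_eq_norm_sq (∑ j, s (b j)), sum_inner]
    simp [inner_sum]
  simp_rw [h1]
  rw [← Finset.mul_sum, Finset.sum_comm]
  have h2 : ∀ j : Fin τ, ∑ b : Fin τ → Fin n, ∑ l, inner ℝ (s (b j)) (s (b l))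
      = (Fintype.card (Fin τ → Fin n) : ℝ) * ((1 / (n : ℝ)) * ∑ i, ‖s i‖ ^ 2) := by
    intro j
    rw [Finset.sum_comm, Finset.sum_eq_single j]
    · simp_rw [real_inner_self_eq_norm_sq]
      exact sum_coord hn j (fun i => ‖s i‖ ^ 2)
    · intro l _ hl
      exact sum_cross hn s hs j l hl
    · simp
  simp_rw [h2]
  rw [Finset.sum_const, Finset.card_univ, Fintype.card_fin, nsmul_eq_mul]
  field_simp

lemma norm_avg_sq_le {τ : ℕ} (hτ : 1 ≤ τ) (v : Fin τ → E) :
    ‖(1 / (τ : ℝ)) • ∑ j, v j‖ ^ 2 ≤ (1 / (τ : ℝ)) * ∑ j, ‖v j‖ ^ 2 := by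
  have hτ' : (0 : ℝ) < τ := by positivity
  have h1 : ‖∑ j, v j‖ ≤ ∑ j, ‖v j‖ := norm_sum_le _ _
  have h2 : (∑ j, ‖v j‖) ^ 2 ≤ (τ : ℝ) * ∑ j, ‖v j‖ ^ 2 := by
    have := sq_sum_le_card_mul_sum_sq (s := (Finset.univ : Finset (Fin τ))) (f := fun j => ‖v j‖)
    simpa using this
  have h3 : ‖∑ j, v j‖ ^ 2 ≤ (τ : ℝ) * ∑ j, ‖v j‖ ^ 2 :=
    (pow_le_pow_left₀ (norm_nonneg _) h1 2).trans h2
  rw [norm_smul, mul_pow, Real.norm_of_nonneg (by positivity)]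
  calc (1 / (τ : ℝ)) ^ 2 * ‖∑ j, v j‖ ^ 2 ≤ (1 / (τ : ℝ)) ^ 2 * ((τ : ℝ) * ∑ j, ‖v j‖ ^ 2) := by
        gcongr
    _ = _ := by field_simp

lemma norm_add_sq_le_two (a b : E) : ‖a + b‖ ^ 2 ≤ 2 * ‖a‖ ^ 2 + 2 * ‖b‖ ^ 2 := by
  have h1 := norm_add_sq_real a b
  have h2 := norm_sub_sq_real a b
  nlinarith [sq_nonneg ‖a - b‖]

lemma vec_step (r e w s : E) (β μ : ℝ) (hβ : 0 < β) (hμ : 0 < μ) :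
    ‖r - β • (e + w + s)‖ ^ 2 ≤ (1 + β * μ / 4) * ‖r‖ ^ 2 - 2 * β * inner ℝ (w + s) r
      + (4 * β / μ + 2 * β ^ 2) * ‖e‖ ^ 2 + 4 * β ^ 2 * ‖w‖ ^ 2 + 4 * β ^ 2 * ‖s‖ ^ 2 := by
  have h1 := norm_sub_sq_real r (β • (e + w + s))
  have h2 : inner ℝ r (β • (e + w + s)) = β * (inner ℝ e r + inner ℝ (w + s) r) := by
    rw [inner_smul_right, add_assoc, inner_add_right, real_inner_comm, real_inner_comm (w + s)]
  have h3 : ‖β • (e + w + s)‖ ^ 2 = β ^ 2 * ‖e + w + s‖ ^ 2 := by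
    rw [norm_smul, mul_pow]; simp
  have h4 := norm_add_sq_le_two e (w + s)
  have h5 := norm_add_sq_le_two w s
  rw [← add_assoc] at h4
  have h6 : 0 ≤ ‖(μ / 4) • r + e‖ ^ 2 := by positivity
  rw [norm_add_sq_real, norm_smul, mul_pow, inner_smul_left, Real.norm_of_nonneg (by positivity),
    real_inner_comm] at h6
  simp only [conj_trivial] at h6
  have h7 : -2 * inner ℝ e r ≤ μ / 4 * ‖r‖ ^ 2 + 4 / μ * ‖e‖ ^ 2 := by
    have : 0 ≤ (4 / μ) * ((μ / 4) ^ 2 * ‖r‖ ^ 2 + 2 * (μ / 4 * inner ℝ e r) + ‖e‖ ^ 2) := by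
      positivity
    have e1 : (4 / μ) * ((μ / 4) ^ 2 * ‖r‖ ^ 2 + 2 * (μ / 4 * inner ℝ e r) + ‖e‖ ^ 2)
      = μ / 4 * ‖r‖ ^ 2 + 2 * inner ℝ e r + 4 / μ * ‖e‖ ^ 2 := by
      field_simp
    linarith
  have h8 := mul_le_mul_of_nonneg_left h7 hβ.le
  have h9 : ‖e + w + s‖ ^ 2 ≤ 2 * ‖e‖ ^ 2 + 4 * ‖w‖ ^ 2 + 4 * ‖s‖ ^ 2 := by linarith
  have h10 := mul_le_mul_of_nonneg_left h9 (sq_nonneg β)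
  rw [h1, h2, h3]
  have e2 : 4 * β / μ = β * (4 / μ) := by ring
  rw [e2]
  linarith

/-- One step in expectation. -/
lemma one_step {n τ : ℕ} (hn : 1 ≤ n) (hτ : 1 ≤ τ) (L μ β δ : ℝ) (hμ : 0 < μ) (hμL : μ ≤ L)
    (hβ : 0 < β) (hβL : β * L ≤ 1 / 20) (hδL : δ ^ 2 * (16 * L) ≤ μ)
    (r : E) (a s : Fin n → E) (hs : ∑ i, s i = 0)
    (hco : ∀ i, ‖a i - s i‖ ^ 2 ≤ L * inner ℝ (a i - s i) r)
    (hsm : ∀ i, μ / 2 * ‖r‖ ^ 2 ≤ inner ℝ (a i - s i) r)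
    (h : (Fin τ → Fin n) → Fin τ → E)
    (hacc : ∀ b j, ‖h b j - a (b j)‖ ^ 2 ≤ δ ^ 2 * ‖a (b j)‖ ^ 2) :
    ∑ b : Fin τ → Fin n, ‖r - (β / (τ : ℝ)) • ∑ j, h b j‖ ^ 2 ≤
      (Fintype.card (Fin τ → Fin n) : ℝ) * ((1 - β * μ / 4) * ‖r‖ ^ 2
        + (8 * β * δ ^ 2 / μ + 4 * β ^ 2 / τ + 4 * β ^ 2 * δ ^ 2)
          * ((1 / (n : ℝ)) * ∑ i, ‖s i‖ ^ 2)) := by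
  have hτ' : (0 : ℝ) < τ := by positivity
  have hn' : (0 : ℝ) < n := by positivity
  have hL : 0 < L := by linarith
  set c : ℝ := 4 * β / μ + 2 * β ^ 2 with hc
  have hcpos : 0 ≤ c := by positivity
  set ψ : Fin n → ℝ := fun i => -(2 * β * inner ℝ (a i) r) + c * (δ ^ 2 * ‖a i‖ ^ 2)
      + 4 * β ^ 2 * ‖a i - s i‖ ^ 2 with hψ
  have key : ∀ b : Fin τ → Fin n, ‖r - (β / (τ : ℝ)) • ∑ j, h b j‖ ^ 2 ≤
      (1 + β * μ / 4) * ‖r‖ ^ 2 + (1 / (τ : ℝ)) * ∑ j, ψ (b j)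
        + 4 * β ^ 2 * ‖(1 / (τ : ℝ)) • ∑ j, s (b j)‖ ^ 2 := by
    intro b
    have v := vec_step r ((1 / (τ : ℝ)) • ∑ j, (h b j - a (b j)))
      ((1 / (τ : ℝ)) • ∑ j, (a (b j) - s (b j))) ((1 / (τ : ℝ)) • ∑ j, s (b j)) β μ hβ hμ
    have e1 : β • ((1 / (τ : ℝ)) • ∑ j, (h b j - a (b j))
        + (1 / (τ : ℝ)) • ∑ j, (a (b j) - s (b j)) + (1 / (τ : ℝ)) • ∑ j, s (b j))
        = (β / (τ : ℝ)) • ∑ j, h b j := by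
      simp only [Finset.sum_sub_distrib, ← smul_add, smul_smul]
      rw [sub_add_sub_cancel, sub_add_cancel, mul_one_div]
    have e2 : inner ℝ ((1 / (τ : ℝ)) • ∑ j, (a (b j) - s (b j)) + (1 / (τ : ℝ)) • ∑ j, s (b j)) r
        = (1 / (τ : ℝ)) * ∑ j, inner ℝ (a (b j)) r := by
      simp only [Finset.sum_sub_distrib, ← smul_add, sub_add_cancel]
      rw [real_inner_smul_left, sum_inner]
    rw [e1, e2] at v
    have b1 : ‖(1 / (τ : ℝ)) • ∑ j, (h b j - a (b j))‖ ^ 2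
        ≤ (1 / (τ : ℝ)) * ∑ j, δ ^ 2 * ‖a (b j)‖ ^ 2 := by
      refine (norm_avg_sq_le hτ _).trans ?_
      gcongr with j
      exact hacc b j
    have b2 := norm_avg_sq_le hτ (fun j => a (b j) - s (b j))
    have b1' := mul_le_mul_of_nonneg_left b1 hcpos
    have b2' := mul_le_mul_of_nonneg_left b2 (by positivity : 0 ≤ 4 * β ^ 2)
    have e3 : (1 / (τ : ℝ)) * ∑ j, ψ (b j) = -(2 * β * ((1 / (τ : ℝ)) * ∑ j, inner ℝ (a (b j)) r))
        + c * ((1 / (τ : ℝ)) * ∑ j, δ ^ 2 * ‖a (b j)‖ ^ 2)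
        + 4 * β ^ 2 * ((1 / (τ : ℝ)) * ∑ j, ‖a (b j) - s (b j)‖ ^ 2) := by
      simp only [hψ, Finset.sum_add_distrib, Finset.sum_neg_distrib, ← Finset.mul_sum]
      ring
    rw [e3]
    linarith
  have hψle : ∀ i, ψ i ≤ -(2 * β * inner ℝ (s i) r) - β * μ / 2 * ‖r‖ ^ 2
      + (8 * β * δ ^ 2 / μ + 4 * β ^ 2 * δ ^ 2) * ‖s i‖ ^ 2 := by
    intro i
    have q1 : ‖a i‖ ^ 2 ≤ 2 * ‖a i - s i‖ ^ 2 + 2 * ‖s i‖ ^ 2 := by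
      have := norm_add_sq_le_two (a i - s i) (s i)
      rwa [sub_add_cancel] at this
    have q2 : inner ℝ (a i) r = inner ℝ (a i - s i) r + inner ℝ (s i) r := by
      rw [← inner_add_left, sub_add_cancel]
    have hc1 := hco i
    have hs1 := hsm i
    set p := inner ℝ (a i - s i) r
    have hp : 0 ≤ p := le_trans (by positivity) hs1
    have q3 : c * (δ ^ 2 * ‖a i‖ ^ 2) ≤ c * (δ ^ 2 * (2 * (L * p) + 2 * ‖s i‖ ^ 2)) := by
      gcongr
      linarith
    have q4 : 4 * β ^ 2 * ‖a i - s i‖ ^ 2 ≤ 4 * β ^ 2 * (L * p) := by gcongr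
    have q5 : c * δ ^ 2 * 2 = 8 * β * δ ^ 2 / μ + 4 * β ^ 2 * δ ^ 2 := by
      rw [hc]; ring
    have q6 : 8 * β * δ ^ 2 / μ * L ≤ β / 2 := by
      rw [div_mul_eq_mul_div, div_le_iff₀ hμ]
      nlinarith
    have q7 : β ^ 2 * L ≤ β / 20 := by nlinarith
    have q8 : δ ^ 2 ≤ 1 / 16 := by nlinarith
    have q9 : 4 * β ^ 2 * δ ^ 2 * L ≤ β / 80 := by
      have : (β ^ 2 * L) * δ ^ 2 ≤ (β / 20) * (1 / 16) := by gcongr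
      linarith
    have q10 : (c * δ ^ 2 * 2 * L + 4 * β ^ 2 * L) * p ≤ β * p := by
      refine mul_le_mul_of_nonneg_right ?_ hp
      rw [q5]
      linarith
    have q11 : β * (μ / 2 * ‖r‖ ^ 2) ≤ β * p := by gcongr
    simp only [hψ]
    rw [q2, ← q5]
    linarith
  have havg : (1 / (n : ℝ)) * ∑ i, ψ i ≤ - (β * μ / 2 * ‖r‖ ^ 2)
      + (8 * β * δ ^ 2 / μ + 4 * β ^ 2 * δ ^ 2) * ((1 / (n : ℝ)) * ∑ i, ‖s i‖ ^ 2) := by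
    have := Finset.sum_le_sum (fun i (_ : i ∈ Finset.univ) => hψle i)
    clear_value ψ
    rw [Finset.sum_add_distrib, Finset.sum_sub_distrib, Finset.sum_neg_distrib, ← Finset.mul_sum,
      ← Finset.mul_sum, ← Finset.mul_sum, ← sum_inner, hs, inner_zero_left, Finset.sum_const, Finset.card_univ,
      Fintype.card_fin, nsmul_eq_mul] at this
    have t := mul_le_mul_of_nonneg_left this (by positivity : 0 ≤ 1 / (n : ℝ))
    refine t.trans (le_of_eq ?_)
    field_simp
    ring
  refine (Finset.sum_le_sum (fun b _ => key b)).trans ?_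
  rw [Finset.sum_add_distrib, Finset.sum_add_distrib, sum_avg_coord hn hτ,
    ← Finset.mul_sum Finset.univ _ (4 * β ^ 2),
    sum_batch_var hn hτ s hs, Finset.sum_const, Finset.card_univ, nsmul_eq_mul]
  have hN : (0 : ℝ) ≤ (Fintype.card (Fin τ → Fin n) : ℝ) := by positivity
  have t := mul_le_mul_of_nonneg_left havg hN
  set N := (Fintype.card (Fin τ → Fin n) : ℝ)
  refine (add_le_add_left (add_le_add_right t _) _).trans (le_of_eq ?_)
  ring

lemma descent_lemma [CompleteSpace E] (f : E → ℝ) (f' : E → E) (L : ℝ)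
    (hgrad : ∀ x, HasGradientAt f (f' x) x)
    (hlip : ∀ x y, ‖f' x - f' y‖ ≤ L * ‖x - y‖) (x y : E) :
    f y ≤ f x + inner ℝ (f' x) (y - x) + L / 2 * ‖y - x‖ ^ 2 := by
  set v := y - x with hv
  have hd : ∀ t : ℝ, HasDerivAt (fun t : ℝ => f (x + t • v) - t * inner ℝ (f' x) v
      - L / 2 * t ^ 2 * ‖v‖ ^ 2)
      (inner ℝ (f' (x + t • v)) v - inner ℝ (f' x) v - L * t * ‖v‖ ^ 2) t := by
    intro t
    have hl : HasDerivAt (fun t : ℝ => x + t • v) v t := by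
      simpa using ((hasDerivAt_id t).smul_const v).const_add x
    have h1 : HasDerivAt (fun t : ℝ => f (x + t • v)) (inner ℝ (f' (x + t • v)) v) t := by
      have := (hgrad (x + t • v)).hasFDerivAt.comp_hasDerivAt t hl
      rw [InnerProductSpace.toDual_apply_apply] at this
      exact this
    have h2 : HasDerivAt (fun t : ℝ => t * inner ℝ (f' x) v) (inner ℝ (f' x) v) t := by
      simpa using (hasDerivAt_id t).mul_const (inner ℝ (f' x) v)
    have h3 : HasDerivAt (fun t : ℝ => L / 2 * t ^ 2 * ‖v‖ ^ 2) (L * t * ‖v‖ ^ 2) t := by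
      have := ((hasDerivAt_pow 2 t).const_mul (L / 2)).mul_const (‖v‖ ^ 2)
      refine this.congr_deriv ?_
      push_cast
      ring
    exact (h1.sub h2).sub h3
  have hanti : AntitoneOn (fun t : ℝ => f (x + t • v) - t * inner ℝ (f' x) v
      - L / 2 * t ^ 2 * ‖v‖ ^ 2) (Set.Icc 0 1) := by
    refine antitoneOn_of_deriv_nonpos (convex_Icc 0 1)
      (fun t _ => (hd t).continuousAt.continuousWithinAt)
      (fun t _ => (hd t).differentiableAt.differentiableWithinAt) ?_
    intro t ht
    rw [interior_Icc] at ht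
    rw [(hd t).deriv, ← inner_sub_left]
    have h1 := real_inner_le_norm (f' (x + t • v) - f' x) v
    have h2 := hlip (x + t • v) x
    rw [add_sub_cancel_left, norm_smul, Real.norm_of_nonneg ht.1.le] at h2
    have h3 := mul_le_mul_of_nonneg_right h2 (norm_nonneg v)
    nlinarith
  have := hanti (by simp : (0 : ℝ) ∈ Set.Icc (0 : ℝ) 1) (by simp : (1 : ℝ) ∈ Set.Icc (0 : ℝ) 1)
    zero_le_one
  simp [hv] at this
  rw [hv]
  linarith

lemma bregman_lower [CompleteSpace E] (f : E → ℝ) (f' : E → E) (L μ : ℝ) (hμ : 0 < μ) (hL : 0 < L)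
    (hgrad : ∀ x, HasGradientAt f (f' x) x)
    (hlip : ∀ x y, ‖f' x - f' y‖ ≤ L * ‖x - y‖)
    (hsc : ∀ x y, f x + inner ℝ (f' x) (y - x) + μ / 2 * ‖y - x‖ ^ 2 ≤ f y) (a b : E) :
    f a + inner ℝ (f' a) (b - a) + 1 / (2 * L) * ‖f' b - f' a‖ ^ 2 ≤ f b := by
  set g := f' b - f' a with hg
  have h1 := descent_lemma f f' L hgrad hlip b (b - (1 / L) • g)
  have h2 := hsc a (b - (1 / L) • g)
  have h3 : 0 ≤ μ / 2 * ‖b - (1 / L) • g - a‖ ^ 2 := by positivity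
  have e1 : b - (1 / L) • g - b = -((1 / L) • g) := by abel
  have e2 : b - (1 / L) • g - a = (b - a) - (1 / L) • g := by abel
  have e3 : L / 2 * ‖-((1 / L) • g)‖ ^ 2 = 1 / (2 * L) * ‖g‖ ^ 2 := by
    rw [norm_neg, norm_smul, Real.norm_of_nonneg (by positivity)]
    field_simp
  have e4 : inner ℝ (f' b) g - inner ℝ (f' a) g = ‖g‖ ^ 2 := by
    rw [← inner_sub_left, ← hg, real_inner_self_eq_norm_sq]
  rw [e1, e3, inner_neg_right, real_inner_smul_right] at h1
  rw [e2, inner_sub_right, real_inner_smul_right] at h2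
  rw [e2] at h3
  have e5 : 1 / L * ‖g‖ ^ 2 = 2 * (1 / (2 * L) * ‖g‖ ^ 2) := by field_simp
  have e6 : 1 / L * inner ℝ (f' b) g - 1 / L * inner ℝ (f' a) g = 1 / L * ‖g‖ ^ 2 := by
    rw [← e4, mul_sub]
  linarith

lemma prox_opt [CompleteSpace E] (f : E → ℝ) (f' : E → E) (α : ℝ) (hα : 0 < α)
    (hgrad : ∀ x, HasGradientAt f (f' x) x) (x z : E)
    (hz : IsMinOn (fun w => f w + ‖w - x‖ ^ 2 / (2 * α)) Set.univ z) :
    α⁻¹ • (x - z) = f' z := by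
  have hloc : IsLocalMin (fun w => f w + ‖w - x‖ ^ 2 / (2 * α)) z :=
    hz.isLocalMin Filter.univ_mem
  have h1 := (hgrad z).hasFDerivAt
  have h2 : HasFDerivAt (fun w : E => ‖w - x‖ ^ 2) _ z := ((hasFDerivAt_id z).sub_const x).norm_sq
  have h3 := h1.add (h2.mul_const ((2 * α)⁻¹))
  have h4 := hloc.hasFDerivAt_eq_zero (h3.congr_of_eventuallyEq
    (Filter.Eventually.of_forall (fun w => by simp [div_eq_mul_inv])))
  refine ext_inner_right ℝ (fun v => ?_)
  have h5 := congrArg (fun T : E →L[ℝ] ℝ => T v) h4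
  simp [InnerProductSpace.toDual_apply_apply] at h5
  rw [real_inner_smul_left, ← neg_sub z x, inner_neg_left, inner_sub_left]
  field_simp at h5 ⊢
  linarith

lemma prox_props [CompleteSpace E] (f : E → ℝ) (f' : E → E) (L μ α : ℝ) (hμ : 0 < μ) (hμL : μ ≤ L)
    (hα : 0 < α) (hαL : α * L ≤ 1)
    (hgrad : ∀ x, HasGradientAt f (f' x) x)
    (hlip : ∀ x y, ‖f' x - f' y‖ ≤ L * ‖x - y‖)
    (hsc : ∀ x y, f x + inner ℝ (f' x) (y - x) + μ / 2 * ‖y - x‖ ^ 2 ≤ f y)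
    (x y u v : E) (hu : α⁻¹ • (x - u) = f' u) (hv : α⁻¹ • (y - v) = f' v) :
    ‖f' u - f' v‖ ^ 2 ≤ L * inner ℝ (f' u - f' v) (x - y) ∧
    μ / 2 * ‖x - y‖ ^ 2 ≤ inner ℝ (f' u - f' v) (x - y) := by
  have hL : 0 < L := by linarith
  have hx : x - y = (u - v) + α • (f' u - f' v) := by
    rw [← hu, ← hv, ← smul_sub, smul_smul, mul_inv_cancel₀ hα.ne', one_smul]
    abel
  have hi : inner ℝ (f' u - f' v) (x - y)
      = inner ℝ (f' u - f' v) (u - v) + α * ‖f' u - f' v‖ ^ 2 := by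
    rw [hx, inner_add_right, real_inner_smul_right, real_inner_self_eq_norm_sq]
  have hswap : inner ℝ (f' u - f' v) (u - v)
      = - inner ℝ (f' u) (v - u) - inner ℝ (f' v) (u - v) := by
    rw [inner_sub_left, ← neg_sub u v, inner_neg_right]
    ring
  have hco : 1 / L * ‖f' u - f' v‖ ^ 2 ≤ inner ℝ (f' u - f' v) (u - v) := by
    have a1 := bregman_lower f f' L μ hμ hL hgrad hlip hsc u v
    have a2 := bregman_lower f f' L μ hμ hL hgrad hlip hsc v u
    rw [norm_sub_rev (f' v)] at a1
    have e5 : 1 / L * ‖f' u - f' v‖ ^ 2 = 2 * (1 / (2 * L) * ‖f' u - f' v‖ ^ 2) := by field_simp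
    linarith
  have hst : μ * ‖u - v‖ ^ 2 ≤ inner ℝ (f' u - f' v) (u - v) := by
    have a1 := hsc u v
    have a2 := hsc v u
    rw [norm_sub_rev v u] at a1
    linarith
  have hnn : 0 ≤ α * ‖f' u - f' v‖ ^ 2 := by positivity
  constructor
  · rw [hi]
    have := mul_le_mul_of_nonneg_left hco hL.le
    rw [← mul_assoc, mul_one_div_cancel hL.ne', one_mul] at this
    nlinarith
  · rw [hi]
    have h2 := norm_add_sq_le_two (u - v) (α • (f' u - f' v))
    rw [← hx, norm_smul α, mul_pow, Real.norm_of_nonneg hα.le] at h2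
    have h3 : μ * α ≤ 1 := by nlinarith
    have h4 : μ * α * (α * ‖f' u - f' v‖ ^ 2) ≤ 1 * (α * ‖f' u - f' v‖ ^ 2) := by gcongr
    have h5 := mul_le_mul_of_nonneg_left h2 (by positivity : 0 ≤ μ / 2)
    linarith

end Helpers

/-- Convergence of FO-MuML (Theorem 5 of the paper).
Task losses f_i are L-smooth and μ-strongly convex, 0 < α ≤ 1/L, 0 < β ≤ 1/(20L),
0 ≤ δ ≤ 1/(4√κ).  z_i(x) is the unique prox point, ∇F_i(x) = (x − z_i(x))/α,
x* stationary, σ*² the gradient variance at x*.  Any FO-MuML process with inner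
solutions ẑ_{t,j}(S) (depending only on the history of length t+1) satisfying the
δ-relative accuracy condition and updates
x^{t+1} = x^t − (β/τ)Σ_j ∇f_{i_{t,j}}(ẑ_{t,j}) satisfies, on uniform average over
histories S ∈ ({1,…,n}^τ)^k,
E‖x^k − x*‖² ≤ (1 − βμ/4)^k‖x^0 − x*‖² + (16/μ)(2δ²/μ + β/τ + βδ²)σ*². -/
theorem fomuml_convergence {d : ℕ} (n τ k : ℕ)
    (hn : 1 ≤ n) (hτ : 1 ≤ τ) (hk : 1 ≤ k)
    (L μ : ℝ) (hμ : 0 < μ) (hμL : μ ≤ L)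
    (f : Fin n → EuclideanSpace ℝ (Fin d) → ℝ)
    (f' : Fin n → EuclideanSpace ℝ (Fin d) → EuclideanSpace ℝ (Fin d))
    (hgrad : ∀ i x, HasGradientAt (f i) (f' i x) x)
    (hlip : ∀ i x y, ‖f' i x - f' i y‖ ≤ L * ‖x - y‖)
    (hsc : ∀ i x y, f i x + @inner ℝ _ _ (f' i x) (y - x) + μ / 2 * ‖y - x‖ ^ 2 ≤ f i y)
    (α β δ : ℝ) (hα : 0 < α) (hαle : α ≤ 1 / L)
    (hβ : 0 < β) (hβle : β ≤ 1 / (20 * L))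
    (hδ : 0 ≤ δ) (hδle : δ ≤ 1 / (4 * Real.sqrt (L / μ)))
    (z : Fin n → EuclideanSpace ℝ (Fin d) → EuclideanSpace ℝ (Fin d))
    (hz : ∀ i x, IsMinOn (fun w => f i w + ‖w - x‖ ^ 2 / (2 * α)) Set.univ (z i x))
    (hzu : ∀ i x w, IsMinOn (fun w' => f i w' + ‖w' - x‖ ^ 2 / (2 * α)) Set.univ w →
      w = z i x)
    (xstar : EuclideanSpace ℝ (Fin d))
    (hstar : ∑ i : Fin n, α⁻¹ • (xstar - z i xstar) = 0)
    (σs : ℝ) (hσ : σs = (1 / (n : ℝ)) * ∑ i : Fin n, ‖α⁻¹ • (xstar - z i xstar)‖ ^ 2)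
    (x0 : EuclideanSpace ℝ (Fin d))
    (X : (Fin k → Fin τ → Fin n) → ℕ → EuclideanSpace ℝ (Fin d))
    (Z : (Fin k → Fin τ → Fin n) → Fin k → Fin τ → EuclideanSpace ℝ (Fin d))
    -- ẑ_{t,j} depends only on the history of length t+1:
    (hZmeas : ∀ S S' (t : Fin k), (∀ t' : Fin k, t' ≤ t → S t' = S' t') →
      ∀ j : Fin τ, Z S t j = Z S' t j)
    -- δ-relative inner accuracy:
    (hZacc : ∀ S (t : Fin k) (j : Fin τ),
      ‖α⁻¹ • (X S t.val - Z S t j) - α⁻¹ • (X S t.val - z (S t j) (X S t.val))‖ ≤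
        δ * ‖α⁻¹ • (X S t.val - z (S t j) (X S t.val))‖)
    (hX0 : ∀ S, X S 0 = x0)
    (hXrec : ∀ S (t : Fin k), X S (t.val + 1) =
      X S t.val - (β / (τ : ℝ)) • ∑ j : Fin τ, f' (S t j) (Z S t j)) :
    (∑ S : Fin k → Fin τ → Fin n, ‖X S k - xstar‖ ^ 2) /
        (Fintype.card (Fin k → Fin τ → Fin n) : ℝ) ≤
      (1 - β * μ / 4) ^ k * ‖x0 - xstar‖ ^ 2 +
        (16 / μ) * (2 * δ ^ 2 / μ + β / (τ : ℝ) + β * δ ^ 2) * σs := by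
  classical
  have hL : 0 < L := by linarith
  have hτ' : (0 : ℝ) < τ := by positivity
  have hn' : (0 : ℝ) < n := by positivity
  have hαL : α * L ≤ 1 := by rwa [le_div_iff₀ hL] at hαle
  have hβL : β * L ≤ 1 / 20 := by
    rw [le_div_iff₀ (by positivity)] at hβle
    linarith
  have hδL : δ ^ 2 * (16 * L) ≤ μ := by
    have hκ : 0 < L / μ := by positivity
    have hs : 0 < Real.sqrt (L / μ) := Real.sqrt_pos.mpr hκ
    rw [le_div_iff₀ (by positivity)] at hδle
    have h1 : (δ * (4 * Real.sqrt (L / μ))) ^ 2 ≤ 1 ^ 2 :=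
      pow_le_pow_left₀ (by positivity) hδle 2
    rw [mul_pow, mul_pow, Real.sq_sqrt hκ.le] at h1
    have h2 := mul_le_mul_of_nonneg_right h1 hμ.le
    have e : δ ^ 2 * (4 ^ 2 * (L / μ)) * μ = δ ^ 2 * (16 * L) := by
      field_simp
      norm_num
    linarith
  have hopt : ∀ i x, α⁻¹ • (x - z i x) = f' i (z i x) := fun i x =>
    prox_opt (f i) (f' i) α hα (hgrad i) x (z i x) (hz i x)
  -- adaptedness
  have hadapt : ∀ m : ℕ, m ≤ k → ∀ S S' : Fin k → Fin τ → Fin n,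
      (∀ t' : Fin k, t'.val < m → S t' = S' t') → X S m = X S' m := by
    intro m
    induction m with
    | zero => intro _ S S' _; rw [hX0, hX0]
    | succ m ih =>
      intro hm S S' hSS
      have hmk : m < k := hm
      have r1 := hXrec S ⟨m, hmk⟩
      have r2 := hXrec S' ⟨m, hmk⟩
      simp only at r1 r2
      rw [r1, r2, ih hmk.le S S' (fun t' ht' => hSS t' (by omega))]
      have hS : S ⟨m, hmk⟩ = S' ⟨m, hmk⟩ := hSS _ (by simp)
      have hZ := hZmeas S S' ⟨m, hmk⟩ (fun t' ht' => hSS t' (by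
        have : t'.val ≤ m := ht'
        omega))
      simp only [hS, hZ]
  set noise : ℝ := (8 * β * δ ^ 2 / μ + 4 * β ^ 2 / τ + 4 * β ^ 2 * δ ^ 2) * σs with hnoise
  set N : ℝ := (Fintype.card (Fin τ → Fin n) : ℝ) with hN
  set M : ℝ := (Fintype.card (Fin k → Fin τ → Fin n) : ℝ) with hM
  have : Nonempty (Fin n) := ⟨⟨0, hn⟩⟩
  have hNpos : 0 < N := by rw [hN]; exact_mod_cast Fintype.card_pos
  have hMpos : 0 < M := by rw [hM]; exact_mod_cast Fintype.card_pos
  have hσ0 : 0 ≤ σs := by rw [hσ]; positivity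
  have hn0 : 0 ≤ noise := by rw [hnoise]; positivity
  have hq0 : 0 ≤ 1 - β * μ / 4 := by nlinarith
  have step : ∀ t : Fin k, ∑ S, ‖X S (t.val + 1) - xstar‖ ^ 2 ≤
      (1 - β * μ / 4) * ∑ S, ‖X S t.val - xstar‖ ^ 2 + M * noise := by
    intro t
    have hre := sum_update_resample t (fun S => ‖X S (t.val + 1) - xstar‖ ^ 2)
    have hone : ∀ S : Fin k → Fin τ → Fin n,
        ∑ b, ‖X (Function.update S t b) (t.val + 1) - xstar‖ ^ 2 ≤
          N * ((1 - β * μ / 4) * ‖X S t.val - xstar‖ ^ 2 + noise) := by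
      intro S
      have hX : ∀ b, X (Function.update S t b) t.val = X S t.val := fun b =>
        hadapt t.val t.isLt.le _ _ (fun t' ht' => by
          rw [Function.update_of_ne]
          intro h
          rw [h] at ht'
          exact lt_irrefl _ ht')
      have hpp := fun i => prox_props (f i) (f' i) L μ α hμ hμL hα hαL (hgrad i) (hlip i) (hsc i)
        (X S t.val) xstar (z i (X S t.val)) (z i xstar) (hopt i _) (hopt i _)
      have h1 := one_step hn hτ L μ β δ hμ hμL hβ hβL hδL (X S t.val - xstar)
        (fun i => f' i (z i (X S t.val))) (fun i => f' i (z i xstar))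
        (by simpa only [hopt] using hstar)
        (fun i => (hpp i).1) (fun i => (hpp i).2)
        (fun b j => f' (b j) (Z (Function.update S t b) t j))
        (by
          intro b j
          have hac := hZacc (Function.update S t b) t j
          rw [hX b, Function.update_self, hopt, ← hopt, ← smul_sub, sub_sub_sub_cancel_left,
            norm_smul, Real.norm_of_nonneg (by positivity), hopt, norm_sub_rev] at hac
          rw [← mul_pow]
          refine pow_le_pow_left₀ (norm_nonneg _) ?_ 2
          refine (hlip _ _ _).trans ?_
          refine le_trans ?_ hac
          refine mul_le_mul_of_nonneg_right ?_ (norm_nonneg _)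
          rw [inv_eq_one_div, le_div_iff₀ hα]
          linarith)
      have e1 : ∀ b, X (Function.update S t b) (t.val + 1) - xstar
          = X S t.val - xstar - (β / (τ : ℝ)) • ∑ j, f' (b j) (Z (Function.update S t b) t j) := by
        intro b
        rw [hXrec, hX b, Function.update_self]
        abel
      simp_rw [e1]
      refine h1.trans (le_of_eq ?_)
      rw [hnoise, hσ]
      simp only [hopt]
      rfl
    have hsum := Finset.sum_le_sum (fun S (_ : S ∈ Finset.univ) => hone S)
    rw [hre, ← Finset.mul_sum, Finset.sum_add_distrib, ← Finset.mul_sum, Finset.sum_const,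
      Finset.card_univ, nsmul_eq_mul] at hsum
    exact le_of_mul_le_mul_left hsum hNpos
  have main : ∀ m : ℕ, m ≤ k → ∑ S, ‖X S m - xstar‖ ^ 2 ≤
      M * ((1 - β * μ / 4) ^ m * ‖x0 - xstar‖ ^ 2 + 4 / (β * μ) * noise) := by
    intro m
    induction m with
    | zero =>
      intro _
      simp only [hX0, Finset.sum_const, Finset.card_univ, nsmul_eq_mul, pow_zero, one_mul]
      have : 0 ≤ 4 / (β * μ) * noise := by positivity
      refine mul_le_mul_of_nonneg_left (by linarith) hMpos.le
    | succ m ih =>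
      intro hm
      refine (step ⟨m, hm⟩).trans ?_
      have h1 := mul_le_mul_of_nonneg_left (ih (Nat.le_of_succ_le hm)) hq0
      refine (add_le_add_left h1 _).trans (le_of_eq ?_)
      rw [pow_succ]
      field_simp
      ring
  have hfin := main k le_rfl
  rw [div_le_iff₀ hMpos]
  refine hfin.trans (le_of_eq ?_)
  rw [mul_comm]
  congr 2
  rw [hnoise]
  field_simp
  ring
end
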